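/- The spread of the group L₃(2) = SL(3, 𝔽₂) is exactly four: (i) for all nonidentity elements x₁, x₂, x₃, x₄ ∈ SL(3, 𝔽₂) there exists s ∈ SL(3, 𝔽₂) such that ⟨x_i, s⟩ = SL(3, 𝔽₂) for each i ∈ {1,2,3,4}; (ii) there exist nonidentity elements x₁, …, x₅ ∈ SL(3, 𝔽₂) such that for every s ∈ SL(3, 𝔽₂) there is some i with ⟨x_i, s⟩ ≠ SL(3, 𝔽₂). -/

import Mathlib

/-- `L₃(2) = SL(3, 𝔽₂)`. -/
abbrev L32 : Type := Matrix.SpecialLinearGroup (Fin 3) (ZMod 2)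

namespace Spread

/-- A 3×3 Boolean matrix, used for fast computation. -/
structure M9 where
  (a b c d e f g h i : Bool)

namespace M9

def beqB (x y : Bool) : Bool := cond x y (!y)

def beq (x y : M9) : Bool :=
  beqB x.a y.a && (beqB x.b y.b && (beqB x.c y.c && (beqB x.d y.d && (beqB x.e y.e &&
  (beqB x.f y.f && (beqB x.g y.g && (beqB x.h y.h && beqB x.i y.i)))))))

theorem beqB_iff {x y : Bool} : beqB x y = true ↔ x = y := by
  cases x <;> cases y <;> simp [beqB]

theorem beq_iff {x y : M9} : beq x y = true ↔ x = y := by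
  cases x; cases y; simp [beq, beqB_iff]

def xr (x y : Bool) : Bool := cond x (!y) y

def dot (x y z u v w : Bool) : Bool := xr (x && u) (xr (y && v) (z && w))

def mul (x y : M9) : M9 :=
  ⟨dot x.a x.b x.c y.a y.d y.g, dot x.a x.b x.c y.b y.e y.h, dot x.a x.b x.c y.c y.f y.i,
   dot x.d x.e x.f y.a y.d y.g, dot x.d x.e x.f y.b y.e y.h, dot x.d x.e x.f y.c y.f y.i,
   dot x.g x.h x.i y.a y.d y.g, dot x.g x.h x.i y.b y.e y.h, dot x.g x.h x.i y.c y.f y.i⟩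

def one : M9 := ⟨true, false, false, false, true, false, false, false, true⟩

/-- Evaluate a Boolean before passing it on. -/
def frc {α : Type} (b : Bool) (k : Bool → α) : α := cond b (k true) (k false)

theorem frc_eq {α : Type} (b : Bool) (k : Bool → α) : frc b k = k b := by cases b <;> rfl

/-- Evaluate all entries before passing the matrix on. -/
def force {α : Type} (x : M9) (k : M9 → α) : α :=
  match x with
  | ⟨a, b, c, d, e, f, g, h, i⟩ =>
    frc a fun a => frc b fun b => frc c fun c => frc d fun d => frc e fun e => frc f fun f =>
    frc g fun g => frc h fun h => frc i fun i => k ⟨a, b, c, d, e, f, g, h, i⟩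

theorem force_eq {α : Type} (x : M9) (k : M9 → α) : force x k = k x := by
  cases x; simp [force, frc_eq]

def det (x : M9) : Bool :=
  dot x.a x.b x.c (xr (x.e && x.i) (x.f && x.h)) (xr (x.d && x.i) (x.f && x.g))
    (xr (x.d && x.h) (x.e && x.g))

/-- The characteristic polynomial is `X³ + X + 1`. -/
def isSev (x : M9) : Bool :=
  beqB (xr x.a (xr x.e x.i)) false &&
  xr (xr (x.a && x.e) (x.b && x.d)) (xr (xr (x.a && x.i) (x.c && x.g))
    (xr (x.e && x.i) (x.f && x.h)))

def allB (p : Bool → Bool) : Bool := p true && p false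

theorem allB_iff {p : Bool → Bool} : allB p = true ↔ ∀ b, p b = true := by
  simp [allB, and_comm]

/-- Quantification over all matrices of determinant one. -/
def allM (p : M9 → Bool) : Bool :=
  allB fun a => allB fun b => allB fun c => allB fun d => allB fun e => allB fun f =>
  allB fun g => allB fun h => allB fun i =>
    !(det ⟨a, b, c, d, e, f, g, h, i⟩) || p ⟨a, b, c, d, e, f, g, h, i⟩

theorem allM_iff {p : M9 → Bool} : allM p = true ↔ ∀ x, det x = true → p x = true := by
  simp only [allM, allB_iff, Bool.or_eq_true, Bool.not_eq_true']
  constructor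
  · rintro h ⟨a, b, c, d, e, f, g, h', i⟩ hx
    rcases h a b c d e f g h' i with h | h
    · rw [h] at hx; cases hx
    · exact h
  · intro h a b c d e f g h' i
    cases hd : det ⟨a, b, c, d, e, f, g, h', i⟩
    · exact Or.inl rfl
    · exact Or.inr (h _ hd)

def exM (p : M9 → Bool) : Bool := !(allM fun x => !(p x))

theorem exM_iff {p : M9 → Bool} : exM p = true ↔ ∃ x, det x = true ∧ p x = true := by
  have h := @allM_iff (fun x => !(p x))
  rw [exM, Bool.not_eq_true', ← Bool.not_eq_true, h]
  push Not
  simp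

/-- Entry of the group element as a Boolean. -/
def bit (z : ZMod 2) : Bool := decide (z = 1)

def unbit (b : Bool) : ZMod 2 := cond b 1 0

theorem bit_unbit (b : Bool) : bit (unbit b) = b := by revert b; decide
theorem unbit_bit (z : ZMod 2) : unbit (bit z) = z := by revert z; decide
theorem bit_inj {y z : ZMod 2} (h : bit y = bit z) : y = z := by
  rw [← unbit_bit y, h, unbit_bit]
theorem bit_mul (y z : ZMod 2) : bit (y * z) = (bit y && bit z) := by revert y z; decide
theorem bit_add (y z : ZMod 2) : bit (y + z) = xr (bit y) (bit z) := by revert y z; decide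
theorem bit_sub (y z : ZMod 2) : bit (y - z) = xr (bit y) (bit z) := by revert y z; decide
theorem xr_assoc (x y z : Bool) : xr (xr x y) z = xr x (xr y z) := by revert x y z; decide

def enc (g : L32) : M9 :=
  ⟨bit (g.1 0 0), bit (g.1 0 1), bit (g.1 0 2), bit (g.1 1 0), bit (g.1 1 1), bit (g.1 1 2),
   bit (g.1 2 0), bit (g.1 2 1), bit (g.1 2 2)⟩

theorem enc_mul (g h : L32) : enc (g * h) = mul (enc g) (enc h) := by
  simp [enc, mul, dot, Matrix.mul_apply, Fin.sum_univ_three, bit_mul, bit_add, xr_assoc]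

theorem enc_one : enc 1 = one := by
  simp [enc, one, bit]

theorem enc_inj {g h : L32} (e : enc g = enc h) : g = h := by
  simp only [enc, M9.mk.injEq] at e
  obtain ⟨h1, h2, h3, h4, h5, h6, h7, h8, h9⟩ := e
  apply Subtype.ext
  ext i j
  fin_cases i <;> fin_cases j <;> apply bit_inj <;> assumption

def toMat (x : M9) : Matrix (Fin 3) (Fin 3) (ZMod 2) :=
  !![unbit x.a, unbit x.b, unbit x.c; unbit x.d, unbit x.e, unbit x.f;
     unbit x.g, unbit x.h, unbit x.i]

theorem bit_det (A : Matrix (Fin 3) (Fin 3) (ZMod 2)) : bit A.det =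
    det ⟨bit (A 0 0), bit (A 0 1), bit (A 0 2), bit (A 1 0), bit (A 1 1), bit (A 1 2),
      bit (A 2 0), bit (A 2 1), bit (A 2 2)⟩ := by
  rw [Matrix.det_fin_three]
  simp only [bit_sub, bit_add, bit_mul, det, dot]
  generalize bit (A 0 0) = a, bit (A 0 1) = b, bit (A 0 2) = c, bit (A 1 0) = d,
    bit (A 1 1) = e, bit (A 1 2) = f, bit (A 2 0) = g, bit (A 2 1) = h, bit (A 2 2) = i
  revert a b c d e f g h i
  decide +kernel

theorem det_enc (g : L32) : det (enc g) = true := by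
  have := bit_det g.1
  rw [g.2] at this
  exact this.symm.trans (by decide)

theorem exists_enc {x : M9} (hx : det x = true) : ∃ g : L32, enc g = x := by
  have h : bit (toMat x).det = det x := by
    rw [bit_det]; simp [toMat, bit_unbit]
  refine ⟨⟨toMat x, ?_⟩, ?_⟩
  · rw [hx] at h
    simpa [bit] using h
  · simp [enc, toMat, bit_unbit]

theorem enc_surj_mem {p : M9 → Bool} (h : allM p = true) (g : L32) : p (enc g) = true :=
  allM_iff.1 h _ (det_enc g)

end M9

open M9

/-- The eight Sylow 7-subgroups, one generator each. -/
def sevens : List M9 := [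
  ⟨false,false,true,false,true,true,true,true,true⟩,
  ⟨false,false,true,true,false,false,true,true,false⟩,
  ⟨false,false,true,true,false,true,false,true,false⟩,
  ⟨false,false,true,true,true,false,false,true,true⟩,
  ⟨false,true,false,true,false,true,true,false,false⟩,
  ⟨false,true,false,true,true,true,false,true,true⟩,
  ⟨false,true,true,false,false,true,true,false,false⟩,
  ⟨false,true,true,true,false,false,false,true,false⟩]

/-- Elements of order four. -/
def fours : List M9 := [
  ⟨false,false,true,false,true,false,true,true,false⟩,
  ⟨false,false,true,false,true,true,true,false,false⟩,
  ⟨true,false,false,true,true,false,false,true,true⟩,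
  ⟨false,false,true,true,true,true,false,true,false⟩,
  ⟨false,true,false,false,true,true,true,true,false⟩,
  ⟨false,false,true,true,false,false,true,true,true⟩,
  ⟨false,true,false,true,false,false,false,true,true⟩,
  ⟨false,true,false,false,false,true,true,true,true⟩,
  ⟨false,true,true,true,false,true,true,true,true⟩,
  ⟨false,true,false,true,false,true,false,false,true⟩,
  ⟨true,false,true,true,true,false,false,false,true⟩]

/-- Words (`true` is the first letter). -/
def wds : List (List Bool) := [
  [false,false,true,false,true,true],
  [false,true],
  [false,false,true,true],
  [false,false,true,true,false,true],
  [false,false,true]]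

/-- Masks. -/
def masks : List Nat := [127, 191, 223, 239, 247, 251, 253, 254, 88053, 113519, 130810, 130975, 177627, 253422, 257399,
  261309, 290223, 315259, 322556, 323287, 439933, 440254, 440295, 473590, 477150, 480063, 481003,
  490847, 491001, 498653, 502715, 515767, 520173, 522959, 523251, 523902]

/-- Minimal pairwise intersections of masks. -/
def masks2 : List Nat := [31, 47, 55, 59, 61, 62, 79, 87, 91, 93, 94, 103, 107, 109, 110, 115, 117, 118, 121, 122, 124,
  143, 151, 155, 157, 158, 167, 171, 173, 174, 179, 181, 182, 185, 186, 188, 199, 203, 205, 206,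
  211, 213, 214, 217, 218, 220, 227, 229, 230, 233, 234, 236, 241, 242, 244, 248, 5585, 6068,
  9611, 17829, 18289, 27818, 27943, 41432, 43591, 43884, 45387, 45870, 46621, 46712, 46818,
  46983, 52281, 52422, 52586, 53019, 59764, 60316, 60565, 61138, 66382, 66481, 70501, 80230,
  80233, 80278, 83924, 86586, 86725, 86837, 87381, 87524, 87668, 87691, 87777, 87792, 87957,
  97370, 97689, 104999, 105176, 105293, 109355, 112685, 113258, 113423, 113507, 122254, 122546,
  126066, 126231, 126696, 126861, 129738, 129939, 130232, 130590, 130714, 135451, 143826, 169068,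
  169107, 169418, 173366, 173395, 173513, 177241, 177242, 177305, 177317, 177562, 177603, 211124,
  214115, 214172, 214358, 217390, 218281, 220494, 220648, 224625, 228381, 231765, 231850, 235980,
  239923, 249190, 252386, 253094, 253100, 256071, 257077, 257381, 260237, 260273, 261180, 264562,
  264589, 271405, 272806, 279063, 279272, 279356, 279950, 280259, 280410, 281899, 289116, 289187,
  289196, 289838, 289927, 290001, 290063, 290217, 296762, 296803, 297817, 304100, 304725, 304790,
  305811, 306104, 313931, 314036, 314232, 314931, 314963, 315241, 322252, 322260, 322544, 323158,
  323269, 394844, 395206, 398119, 398953, 399018, 405620, 406814, 406855, 406968, 407009, 431004,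
  431045, 431669, 434745, 435107, 436140, 438861, 438897, 438926, 439218, 439868, 439909, 439910,
  440230, 459674, 463074, 463158, 463561, 463645, 465364, 469275, 469426, 469476, 473286, 473430,
  473584, 475934, 475949, 476114, 476632, 476822, 476874, 477132, 479545, 479759, 479787, 480051,
  480331, 480874, 480931, 482327, 482481, 486733, 489673, 489811, 490616, 490841, 494489, 498268,
  498325, 498641, 502330, 502411, 502697, 511653, 514695, 515638, 519137, 519788, 522830, 522866,
  522947]

def S0 : M9 := ⟨false,false,true,false,true,true,true,true,true⟩
def Y1 : M9 := ⟨false,false,true,false,true,false,true,false,false⟩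
def Y2 : M9 := ⟨false,false,true,false,true,false,true,true,true⟩
def Y3 : M9 := ⟨false,false,true,false,true,true,true,true,false⟩
def X1 : M9 := ⟨false,false,true,true,false,false,false,true,false⟩
def X2 : M9 := ⟨true,false,true,false,false,true,false,true,true⟩
def X3 : M9 := ⟨false,true,false,true,false,true,true,true,false⟩
def X4 : M9 := ⟨false,false,true,true,false,true,true,true,false⟩
def X5 : M9 := ⟨true,false,false,true,true,false,false,false,true⟩

/-- Triples stabilised (under conjugation) by one of the five elements. -/
def trips : List (Nat × List M9) := [
  (0, [⟨false,true,true,false,true,false,true,true,false⟩, ⟨false,true,true,true,false,true,false,false,true⟩, ⟨true,false,false,true,false,true,true,true,false⟩]),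
  (2, [⟨true,false,false,false,false,true,false,true,false⟩, ⟨true,true,true,false,false,true,false,true,false⟩, ⟨true,true,true,false,true,false,false,false,true⟩]),
  (4, [⟨true,false,false,false,true,false,true,false,true⟩, ⟨true,false,false,true,true,false,false,false,true⟩, ⟨true,false,false,true,true,false,true,false,true⟩]),
  (0, [⟨false,false,true,false,true,true,true,true,true⟩, ⟨true,true,true,true,false,false,true,false,true⟩, ⟨true,true,false,true,true,true,false,true,false⟩]),
  (0, [⟨false,true,false,true,true,true,false,true,true⟩, ⟨true,true,true,true,true,false,true,false,false⟩, ⟨true,false,true,false,false,true,true,true,true⟩]),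
  (1, [⟨false,false,true,true,false,false,true,true,false⟩, ⟨true,true,false,false,false,true,true,false,true⟩, ⟨true,true,true,true,false,true,false,true,true⟩]),
  (1, [⟨false,true,false,true,false,true,true,false,false⟩, ⟨true,false,true,true,true,false,false,true,false⟩, ⟨true,true,true,false,true,true,true,true,false⟩]),
  (2, [⟨false,false,true,true,false,true,false,true,false⟩, ⟨false,true,false,false,true,true,true,false,true⟩, ⟨false,true,true,true,true,false,true,true,true⟩]),
  (2, [⟨false,true,true,true,false,false,false,true,false⟩, ⟨true,true,false,false,true,true,true,false,false⟩, ⟨true,false,true,true,true,true,true,true,false⟩]),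
  (3, [⟨false,false,true,true,true,false,false,true,true⟩, ⟨false,true,true,true,true,true,true,false,true⟩, ⟨false,true,false,false,false,true,true,true,false⟩]),
  (3, [⟨false,true,true,false,false,true,true,false,false⟩, ⟨true,false,true,true,false,false,false,true,true⟩, ⟨true,true,false,true,false,true,true,true,true⟩]),
  (4, [⟨false,false,true,false,true,false,true,false,false⟩, ⟨false,false,true,true,true,true,true,false,false⟩, ⟨true,false,false,true,true,true,false,false,true⟩]),
  (4, [⟨true,false,false,false,true,true,false,false,true⟩, ⟨true,false,true,false,true,false,false,false,true⟩, ⟨true,false,true,false,true,true,false,false,true⟩]),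
  (4, [⟨true,false,false,false,true,false,false,true,true⟩, ⟨true,false,false,false,true,false,true,false,true⟩, ⟨true,false,false,false,true,false,true,true,true⟩]),
  (0, [⟨false,false,true,true,true,true,true,false,false⟩, ⟨false,true,false,true,false,false,true,true,true⟩, ⟨true,true,true,false,false,true,false,true,false⟩]),
  (1, [⟨true,false,true,false,true,false,false,false,true⟩, ⟨true,true,false,false,true,false,false,false,true⟩, ⟨true,true,true,false,true,false,false,false,true⟩]),
  (2, [⟨false,true,false,true,false,false,false,false,true⟩, ⟨false,true,true,true,false,true,false,false,true⟩, ⟨true,false,true,false,true,true,false,false,true⟩]),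
  (3, [⟨false,false,true,false,true,false,true,false,false⟩, ⟨false,true,true,false,true,false,true,true,false⟩, ⟨true,true,false,false,true,false,false,true,true⟩])]

/-- `y` does not normalise the group generated by `w`. -/
def notNorm (y w : M9) : Bool :=
  force (mul y w) fun u => force (mul w w) fun w2 => force (mul w2 w2) fun w4 =>
    !(beq u (mul w y)) && (!(beq u (mul w2 y)) && !(beq u (mul w4 y)))

def NN (y w : L32) : Prop := y * w ≠ w * y ∧ y * w ≠ w * w * y ∧ y * w ≠ w * w * (w * w) * y

theorem beq_enc {g h : L32} : beq (enc g) (enc h) = true ↔ g = h := by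
  rw [beq_iff]; exact ⟨enc_inj, fun e => by rw [e]⟩

theorem notNorm_enc {y w : L32} : notNorm (enc y) (enc w) = true ↔ NN y w := by
  simp only [notNorm, force_eq, ← enc_mul, Bool.and_eq_true, Bool.not_eq_true', NN,
    ← Bool.not_eq_true, beq_enc, ne_eq]

abbrev cl (x s : L32) : Subgroup L32 := Subgroup.closure {x, s}

theorem left_mem (x s : L32) : x ∈ cl x s := Subgroup.subset_closure (by simp)
theorem right_mem (x s : L32) : s ∈ cl x s := Subgroup.subset_closure (by simp)

theorem top_of {x s y t : L32} (h : cl x s = ⊤) (hx : x ∈ cl y t) (hs : s ∈ cl y t) :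
    cl y t = ⊤ := by
  rw [eq_top_iff, ← h]
  refine (Subgroup.closure_le _).2 ?_
  rintro z (rfl | rfl) <;> assumption

/-! Breadth-first search in the group. -/

def mem (x : M9) (l : List M9) : Bool := l.any fun y => beq x y

/-- Work through a queue, multiplying on the right by `x` and `s`. -/
def bfs (x s : M9) : Nat → List M9 → List M9 → List M9
  | 0, _, seen => seen
  | _ + 1, [], seen => seen
  | n + 1, q :: qs, seen =>
    force (mul q x) fun u => force (mul q s) fun v =>
      cond (mem u seen)
        (cond (mem v seen) (bfs x s n qs seen) (bfs x s n (qs ++ [v]) (v :: seen)))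
        (cond (mem v (u :: seen)) (bfs x s n (qs ++ [u]) (u :: seen))
          (bfs x s n (qs ++ [u, v]) (v :: u :: seen)))

theorem bfs_sound (x s : L32) : ∀ (n : Nat) (q l : List M9),
    (∀ m ∈ q, ∃ g ∈ cl x s, enc g = m) → (∀ m ∈ l, ∃ g ∈ cl x s, enc g = m) →
    ∀ m ∈ bfs (enc x) (enc s) n q l, ∃ g ∈ cl x s, enc g = m := by
  intro n
  induction n with
  | zero => intro q l _ hl; simpa [bfs] using hl
  | succ n ih =>
    intro q l hq hl
    cases q with
    | nil => simpa [bfs] using hl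
    | cons q qs =>
      obtain ⟨g, hg, rfl⟩ := hq q (by simp)
      have hqs : ∀ m ∈ qs, ∃ g ∈ cl x s, enc g = m := fun m hm => hq m (by simp [hm])
      have hu : ∃ k ∈ cl x s, enc k = mul (enc g) (enc x) :=
        ⟨g * x, mul_mem hg (left_mem x s), enc_mul _ _⟩
      have hv : ∃ k ∈ cl x s, enc k = mul (enc g) (enc s) :=
        ⟨g * s, mul_mem hg (right_mem x s), enc_mul _ _⟩
      simp only [bfs, force_eq]
      generalize mul (enc g) (enc x) = u at hu
      generalize mul (enc g) (enc s) = v at hv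
      have c1 : ∀ m ∈ u :: l, ∃ g ∈ cl x s, enc g = m := List.forall_mem_cons.2 ⟨hu, hl⟩
      have c2 : ∀ m ∈ v :: l, ∃ g ∈ cl x s, enc g = m := List.forall_mem_cons.2 ⟨hv, hl⟩
      have c3 : ∀ m ∈ v :: u :: l, ∃ g ∈ cl x s, enc g = m := List.forall_mem_cons.2 ⟨hv, c1⟩
      have d1 : ∀ m ∈ qs ++ [u], ∃ g ∈ cl x s, enc g = m :=
        List.forall_mem_append.2 ⟨hqs, List.forall_mem_singleton.2 hu⟩
      have d2 : ∀ m ∈ qs ++ [v], ∃ g ∈ cl x s, enc g = m :=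
        List.forall_mem_append.2 ⟨hqs, List.forall_mem_singleton.2 hv⟩
      have d3 : ∀ m ∈ qs ++ [u, v], ∃ g ∈ cl x s, enc g = m :=
        List.forall_mem_append.2 ⟨hqs, List.forall_mem_cons.2 ⟨hu, List.forall_mem_singleton.2 hv⟩⟩
      cases mem u l
      · cases mem v (u :: l)
        · exact ih _ _ d3 c3
        · exact ih _ _ d1 c1
      · cases mem v l
        · exact ih _ _ d2 c2
        · exact ih _ _ hqs hl

def fullB (n : Nat) (x s : M9) : Bool :=
  allM fun m => mem m (bfs x s n [one] [one])

theorem full_top {n : Nat} {x s : L32} (h : fullB n (enc x) (enc s) = true) : cl x s = ⊤ := by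
  rw [eq_top_iff]
  intro g _
  have h1 : mem (enc g) (bfs (enc x) (enc s) n [one] [one]) = true :=
    enc_surj_mem (p := fun m => mem m (bfs (enc x) (enc s) n [one] [one])) h g
  simp only [mem, List.any_eq_true] at h1
  obtain ⟨m, hm, hb⟩ := h1
  have base : ∀ m ∈ [one], ∃ g ∈ cl x s, enc g = m := by
    intro m hm
    rw [List.mem_singleton] at hm
    exact ⟨1, one_mem _, by rw [enc_one, hm]⟩
  obtain ⟨k, hk, e⟩ := bfs_sound x s n [one] [one] base base m hm
  rw [beq_iff] at hb
  have : g = k := enc_inj (hb.trans e.symm)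
  rwa [this]

theorem full1 : fullB 168 S0 Y1 = true := by decide +kernel
theorem full2 : fullB 168 S0 Y2 = true := by decide +kernel
theorem full3 : fullB 168 S0 Y3 = true := by decide +kernel

/-- Powers of `x`. -/
def pows : Nat → M9 → List M9
  | 0, _ => [one]
  | n + 1, x => match pows n x with
    | [] => []
    | y :: l => force (mul y x) fun z => z :: y :: l

theorem pows_sound (x : L32) (H : Subgroup L32) (hx : x ∈ H) (n : Nat) :
    ∀ m ∈ pows n (enc x), ∃ g ∈ H, enc g = m := by
  induction n with
  | zero =>
    intro m hm
    rw [pows, List.mem_singleton] at hm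
    exact ⟨1, one_mem _, by rw [enc_one, hm]⟩
  | succ n ih =>
    rw [pows]
    cases h : pows n (enc x) with
    | nil => simp
    | cons y l =>
      rw [h] at ih
      simp only [force_eq]
      intro m hm
      rcases List.mem_cons.1 hm with rfl | hm
      · obtain ⟨g, hg, rfl⟩ := ih y (by simp)
        exact ⟨g * x, mul_mem hg hx, enc_mul _ _⟩
      · exact ih m hm

def dcB (y : M9) : Bool :=
  !(notNorm y S0) || (pows 6 S0).any fun p => force (mul p y) fun py =>
    (pows 6 S0).any fun q => force (mul py q) fun z => beq z Y1 || (beq z Y2 || beq z Y3)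

theorem dc_all : allM dcB = true := by decide +kernel

theorem gen_s0 {s y : L32} (hs : enc s = S0) (h : NN y s) : cl s y = ⊤ := by
  have h1 := enc_surj_mem dc_all y
  have h2 := notNorm_enc.2 h
  rw [hs] at h2
  simp only [dcB, h2, Bool.not_true, Bool.false_or, List.any_eq_true, force_eq] at h1
  obtain ⟨p, hp, q, hq, hz⟩ := h1
  rw [← hs] at hp hq
  obtain ⟨p, hp', rfl⟩ := pows_sound s (cl s y) (left_mem s y) 6 p hp
  obtain ⟨q, hq', rfl⟩ := pows_sound s (cl s y) (left_mem s y) 6 q hq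
  have hm : p * y * q ∈ cl s y := mul_mem (mul_mem hp' (right_mem s y)) hq'
  rw [← enc_mul, ← enc_mul] at hz
  have key : fullB 168 (enc s) (enc (p * y * q)) = true := by
    simp only [Bool.or_eq_true, beq_iff] at hz
    rw [hs]
    rcases hz with hz | hz | hz <;> rw [hz]
    · exact full1
    · exact full2
    · exact full3
  exact top_of (full_top key) (left_mem s y) hm

def conjB (w : M9) : Bool := !(isSev w) || exM fun g => beq (mul w g) (mul g S0)

theorem conj_all : allM conjB = true := by decide +kernel

theorem gen_sev {w y : L32} (hw : isSev (enc w) = true) (h : NN y w) : cl w y = ⊤ := by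
  have h1 := enc_surj_mem conj_all w
  simp only [conjB, hw, Bool.not_true, Bool.false_or, exM_iff] at h1
  obtain ⟨m, hm, hb⟩ := h1
  obtain ⟨g, rfl⟩ := exists_enc hm
  obtain ⟨s, hs⟩ := exists_enc (x := S0) (by decide)
  rw [← hs, ← enc_mul, ← enc_mul, beq_enc] at hb
  have hw' : w = g * s * g⁻¹ := by rw [← hb]; group
  obtain ⟨z, rfl⟩ : ∃ z, y = g * z * g⁻¹ := ⟨g⁻¹ * y * g, by group⟩
  subst hw'
  have hz : NN z s := by
    obtain ⟨h1, h2, h3⟩ := h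
    refine ⟨fun e => h1 ?_, fun e => h2 ?_, fun e => h3 ?_⟩
    · calc _ = g * (z * s) * g⁻¹ := by group
        _ = _ := by rw [e]; group
    · calc _ = g * (z * s) * g⁻¹ := by group
        _ = _ := by rw [e]; group
    · calc _ = g * (z * s) * g⁻¹ := by group
        _ = _ := by rw [e]; group
  have ht := gen_s0 hs hz
  have hmap : (cl s z).map (MulAut.conj g).toMonoidHom = cl (g * s * g⁻¹) (g * z * g⁻¹) := by
    rw [MonoidHom.map_closure, Set.image_pair]; rfl
  rw [← hmap, ht]
  exact Subgroup.map_top_of_surjective _ (MulAut.conj g).surjective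

/-- Evaluate a word in `x` and `s`. -/
def ev (x s : M9) : List Bool → M9 → M9
  | [], r => r
  | c :: l, r => force (mul r (cond c x s)) fun r' => ev x s l r'

theorem ev_sound (x s : L32) : ∀ (l : List Bool) (r : L32), r ∈ cl x s →
    ∃ g ∈ cl x s, enc g = ev (enc x) (enc s) l (enc r) := by
  intro l
  induction l with
  | nil => intro r hr; exact ⟨r, hr, rfl⟩
  | cons c l ih =>
    intro r hr
    cases c
    · simp only [ev, force_eq, cond, ← enc_mul]
      exact ih _ (mul_mem hr (right_mem x s))
    · simp only [ev, force_eq, cond, ← enc_mul]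
      exact ih _ (mul_mem hr (left_mem x s))

/-- A sufficient criterion for generation. -/
def genB (W : List (List Bool)) (x s : M9) : Bool :=
  W.any fun l => force (ev x s l one) fun w => isSev w && (notNorm x w || notNorm s w)

theorem gen_of {W : List (List Bool)} {x s : L32} (h : genB W (enc x) (enc s) = true) :
    cl x s = ⊤ := by
  simp only [genB, List.any_eq_true, force_eq, Bool.and_eq_true, Bool.or_eq_true] at h
  obtain ⟨l, _, h1, h2⟩ := h
  rw [← enc_one] at h1 h2
  obtain ⟨g, hg, e⟩ := ev_sound x s l 1 (one_mem _)
  rw [← e] at h1 h2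
  simp only [notNorm_enc] at h2
  rcases h2 with h2 | h2
  · exact top_of (gen_sev h1 h2) hg (left_mem x s)
  · exact top_of (gen_sev h1 h2) hg (right_mem x s)

def cands : List (M9 × List (List Bool)) :=
  sevens.map (fun s => (s, [[false]])) ++ fours.map (fun s => (s, wds))

/-- Every candidate whose bit is set in the mask `m` generates with `x`. -/
def goodB (x : M9) : List (M9 × List (List Bool)) → Nat → Bool
  | [], m => Nat.beq m 0
  | s :: l, m => (Nat.beq (m % 2) 0 || genB s.2 x s.1) && goodB x l (m / 2)

theorem good_sound (x : M9) : ∀ (l : List (M9 × List (List Bool))) (m j : Nat),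
    goodB x l m = true → m.testBit j = true → ∃ s, l[j]? = some s ∧ genB s.2 x s.1 = true := by
  intro l
  induction l with
  | nil =>
    intro m j h hj
    have : m = 0 := Nat.eq_of_beq_eq_true h
    simp [this] at hj
  | cons s l ih =>
    intro m j h hj
    simp only [goodB, Bool.and_eq_true, Bool.or_eq_true] at h
    obtain ⟨h1, h2⟩ := h
    cases j with
    | zero =>
      refine ⟨s, by simp, ?_⟩
      rcases h1 with h1 | h1
      · have := Nat.eq_of_beq_eq_true h1
        simp [Nat.testBit_zero, this] at hj
      · exact h1
    | succ j =>
      rw [Nat.testBit_succ] at hj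
      obtain ⟨t, ht, h3⟩ := ih _ j h2 hj
      exact ⟨t, by simpa using ht, h3⟩

theorem masks_all : allM (fun x => beq x one || masks.any fun m => goodB x cands m) = true := by
  decide +kernel

theorem masks2_all : (masks.all fun a => masks.all fun b => masks2.any fun d =>
    Nat.beq (Nat.land (Nat.land a b) d) d) = true := by decide +kernel

theorem masks4_all : (masks2.all fun a => masks2.all fun b =>
    !(Nat.beq (Nat.land a b) 0)) = true := by decide +kernel

theorem cands_det : (cands.all fun s => det s.1) = true := by decide +kernel

theorem exists_mask {x : L32} (hx : x ≠ 1) : ∃ m ∈ masks, ∀ j, m.testBit j = true →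
    ∃ s, cands[j]? = some s ∧ genB s.2 (enc x) s.1 = true := by
  have h := enc_surj_mem masks_all x
  simp only [Bool.or_eq_true, List.any_eq_true] at h
  rcases h with h | ⟨m, hm, h⟩
  · rw [← enc_one, beq_enc] at h; exact absurd h hx
  · exact ⟨m, hm, fun j hj => good_sound _ _ _ _ h hj⟩

theorem land_sub {a b d : Nat} (h : Nat.beq (Nat.land (Nat.land a b) d) d = true) {j : Nat}
    (hj : d.testBit j = true) : a.testBit j = true ∧ b.testBit j = true := by
  have h' : (a &&& b) &&& d = d := Nat.eq_of_beq_eq_true h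
  rw [← h', Nat.testBit_and, Nat.testBit_and] at hj
  simp only [Bool.and_eq_true] at hj
  exact hj.1

theorem exists_bit {a b c d : Nat} (ha : a ∈ masks) (hb : b ∈ masks) (hc : c ∈ masks)
    (hd : d ∈ masks) : ∃ j, a.testBit j = true ∧ b.testBit j = true ∧ c.testBit j = true ∧
      d.testBit j = true := by
  have h := masks2_all
  simp only [List.all_eq_true, List.any_eq_true] at h
  obtain ⟨u, hu, hu'⟩ := h a ha b hb
  obtain ⟨v, hv, hv'⟩ := h c hc d hd
  have h4 := masks4_all
  simp only [List.all_eq_true, Bool.not_eq_true'] at h4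
  have h5 := h4 u hu v hv
  have h6 : u &&& v ≠ 0 := fun e => by
    have e' : Nat.land u v = 0 := e
    rw [e'] at h5
    exact absurd h5 (by decide)
  obtain ⟨j, hj⟩ := Nat.exists_testBit_of_ne_zero h6
  rw [Nat.testBit_and, Bool.and_eq_true] at hj
  obtain ⟨h7, h8⟩ := land_sub hu' hj.1
  obtain ⟨h9, h10⟩ := land_sub hv' hj.2
  exact ⟨j, h7, h8, h9, h10⟩

theorem part_one (x₁ x₂ x₃ x₄ : L32) (h₁ : x₁ ≠ 1) (h₂ : x₂ ≠ 1) (h₃ : x₃ ≠ 1)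
    (h₄ : x₄ ≠ 1) : ∃ s, cl x₁ s = ⊤ ∧ cl x₂ s = ⊤ ∧ cl x₃ s = ⊤ ∧ cl x₄ s = ⊤ := by
  obtain ⟨a, ha, ka⟩ := exists_mask h₁
  obtain ⟨b, hb, kb⟩ := exists_mask h₂
  obtain ⟨c, hc, kc⟩ := exists_mask h₃
  obtain ⟨d, hd, kd⟩ := exists_mask h₄
  obtain ⟨j, ja, jb, jc, jd⟩ := exists_bit ha hb hc hd
  obtain ⟨s, hs, g1⟩ := ka j ja
  obtain ⟨s2, hs2, g2⟩ := kb j jb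
  obtain ⟨s3, hs3, g3⟩ := kc j jc
  obtain ⟨s4, hs4, g4⟩ := kd j jd
  obtain rfl : s2 = s := by rw [hs] at hs2; exact (Option.some.inj hs2).symm
  obtain rfl : s3 = s2 := by rw [hs] at hs3; exact (Option.some.inj hs3).symm
  obtain rfl : s4 = s3 := by rw [hs] at hs4; exact (Option.some.inj hs4).symm
  have hdet := List.all_eq_true.1 cands_det s4 (List.mem_of_getElem? hs)
  obtain ⟨s, e⟩ := exists_enc hdet
  rw [← e] at g1 g2 g3 g4
  exact ⟨s, gen_of g1, gen_of g2, gen_of g3, gen_of g4⟩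

/-! Second part. -/

/-- `g` permutes the list `T` by conjugation. -/
def stabB (T : List M9) (g : M9) : Bool :=
  (T.all fun t => force (mul g t) fun u => T.any fun t' => beq u (mul t' g)) &&
  (T.all fun t' => force (mul t' g) fun u => T.any fun t => beq (mul g t) u)

/-- The stabiliser under conjugation of a set. -/
def stabS (F : Set L32) : Subgroup L32 where
  carrier := {g | (∀ t ∈ F, ∃ t' ∈ F, g * t = t' * g) ∧ (∀ t' ∈ F, ∃ t ∈ F, g * t = t' * g)}
  one_mem' := ⟨fun t ht => ⟨t, ht, by simp⟩, fun t ht => ⟨t, ht, by simp⟩⟩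
  mul_mem' := by
    rintro g h ⟨g1, g2⟩ ⟨h1, h2⟩
    constructor
    · intro t ht
      obtain ⟨u, hu, e⟩ := h1 t ht
      obtain ⟨v, hv, e'⟩ := g1 u hu
      exact ⟨v, hv, by rw [mul_assoc, e, ← mul_assoc, e', mul_assoc]⟩
    · intro t ht
      obtain ⟨u, hu, e⟩ := g2 t ht
      obtain ⟨v, hv, e'⟩ := h2 u hu
      exact ⟨v, hv, by rw [mul_assoc, e', ← mul_assoc, e, mul_assoc]⟩
  inv_mem' := by
    rintro g ⟨g1, g2⟩
    constructor
    · intro t ht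
      obtain ⟨u, hu, e⟩ := g2 t ht
      exact ⟨u, hu, by rw [inv_mul_eq_iff_eq_mul, ← mul_assoc, e, mul_inv_cancel_right]⟩
    · intro t ht
      obtain ⟨u, hu, e⟩ := g1 t ht
      exact ⟨u, hu, by rw [inv_mul_eq_iff_eq_mul, ← mul_assoc, e, mul_inv_cancel_right]⟩

theorem stab_iff {T : List M9} (hT : T.all det = true) (g : L32) :
    stabB T (enc g) = true ↔ g ∈ stabS {t | enc t ∈ T} := by
  have q : ∀ p : M9 → Prop, (∀ m ∈ T, p m) ↔ ∀ t : L32, enc t ∈ T → p (enc t) := by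
    intro p
    refine ⟨fun h t ht => h _ ht, fun h m hm => ?_⟩
    obtain ⟨t, rfl⟩ := exists_enc (List.all_eq_true.1 hT m hm)
    exact h t hm
  have q' : ∀ p : M9 → Prop, (∃ m ∈ T, p m) ↔ ∃ t : L32, enc t ∈ T ∧ p (enc t) := by
    intro p
    refine ⟨fun ⟨m, hm, h⟩ => ?_, fun ⟨t, ht, h⟩ => ⟨_, ht, h⟩⟩
    obtain ⟨t, rfl⟩ := exists_enc (List.all_eq_true.1 hT m hm)
    exact ⟨t, hm, h⟩
  simp only [stabB, Bool.and_eq_true, List.all_eq_true, List.any_eq_true, force_eq]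
  rw [q, q]
  simp only [q', ← enc_mul, beq_enc]
  rfl

theorem not_top {T : List M9} (hT : T.all det = true) (hp : exM (fun g => !(stabB T g)) = true)
    {x s : L32} (hx : stabB T (enc x) = true) (hs : stabB T (enc s) = true) : cl x s ≠ ⊤ := by
  intro h
  rw [stab_iff hT] at hx hs
  obtain ⟨m, hm, hm'⟩ := exM_iff.1 hp
  obtain ⟨g, rfl⟩ := exists_enc hm
  have hle : cl x s ≤ stabS {t | enc t ∈ T} := by
    refine (Subgroup.closure_le _).2 ?_
    rintro z (rfl | rfl) <;> assumption
  rw [h] at hle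
  have := (stab_iff hT g).2 (hle (Subgroup.mem_top g))
  rw [this] at hm'
  cases hm'

def xs : Nat → M9
  | 0 => X1
  | 1 => X2
  | 2 => X3
  | 3 => X4
  | _ => X5

theorem trips_ok : (trips.all fun p => p.2.all det && (exM (fun g => !(stabB p.2 g)) &&
    stabB p.2 (xs p.1))) = true := by decide +kernel

theorem trips_cover : allM (fun s => trips.any fun p => stabB p.2 s) = true := by decide +kernel

theorem part_two : ∃ x₁ x₂ x₃ x₄ x₅ : L32,
      x₁ ≠ 1 ∧ x₂ ≠ 1 ∧ x₃ ≠ 1 ∧ x₄ ≠ 1 ∧ x₅ ≠ 1 ∧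
      ∀ s : L32, cl x₁ s ≠ ⊤ ∨ cl x₂ s ≠ ⊤ ∨ cl x₃ s ≠ ⊤ ∨ cl x₄ s ≠ ⊤ ∨ cl x₅ s ≠ ⊤ := by
  obtain ⟨x1, h1⟩ := exists_enc (x := X1) (by decide)
  obtain ⟨x2, h2⟩ := exists_enc (x := X2) (by decide)
  obtain ⟨x3, h3⟩ := exists_enc (x := X3) (by decide)
  obtain ⟨x4, h4⟩ := exists_enc (x := X4) (by decide)
  obtain ⟨x5, h5⟩ := exists_enc (x := X5) (by decide)
  have ne : ∀ {x : L32} {m : M9}, enc x = m → beq m one = false → x ≠ 1 := by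
    rintro x m rfl hb rfl
    rw [enc_one] at hb
    exact absurd hb (by decide)
  refine ⟨x1, x2, x3, x4, x5, ne h1 (by decide), ne h2 (by decide), ne h3 (by decide),
    ne h4 (by decide), ne h5 (by decide), fun s => ?_⟩
  have hc := enc_surj_mem trips_cover s
  rw [List.any_eq_true] at hc
  obtain ⟨p, hp, hs⟩ := hc
  have hk := List.all_eq_true.1 trips_ok p hp
  simp only [Bool.and_eq_true] at hk
  obtain ⟨k1, k2, k3⟩ := hk
  have fin : ∀ {x : L32}, enc x = xs p.1 → cl x s ≠ ⊤ := by
    intro x hx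
    exact not_top k1 k2 (by rw [hx]; exact k3) hs
  rcases hn : p.1 with _ | _ | _ | _ | n <;> rw [hn] at fin
  · exact Or.inl (fin h1)
  · exact Or.inr (Or.inl (fin h2))
  · exact Or.inr (Or.inr (Or.inl (fin h3)))
  · exact Or.inr (Or.inr (Or.inr (Or.inl (fin h4))))
  · exact Or.inr (Or.inr (Or.inr (Or.inr (fin h5))))

end Spread

/-- The spread of `L₃(2) = SL(3, 𝔽₂)` is exactly four: (i) for all nonidentity
`x₁, x₂, x₃, x₄` there is `s` generating the group with each of them;
(ii) there are nonidentity `x₁, …, x₅` such that no `s` generates the group with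
all five. -/
theorem stmt_18 :
    (∀ x₁ x₂ x₃ x₄ : L32, x₁ ≠ 1 → x₂ ≠ 1 → x₃ ≠ 1 → x₄ ≠ 1 →
      ∃ s : L32,
        Subgroup.closure {x₁, s} = ⊤ ∧
        Subgroup.closure {x₂, s} = ⊤ ∧
        Subgroup.closure {x₃, s} = ⊤ ∧
        Subgroup.closure {x₄, s} = ⊤) ∧
    (∃ x₁ x₂ x₃ x₄ x₅ : L32,
      x₁ ≠ 1 ∧ x₂ ≠ 1 ∧ x₃ ≠ 1 ∧ x₄ ≠ 1 ∧ x₅ ≠ 1 ∧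
      ∀ s : L32,
        Subgroup.closure {x₁, s} ≠ ⊤ ∨
        Subgroup.closure {x₂, s} ≠ ⊤ ∨
        Subgroup.closure {x₃, s} ≠ ⊤ ∨
        Subgroup.closure {x₄, s} ≠ ⊤ ∨
        Subgroup.closure {x₅, s} ≠ ⊤) := by
  exact ⟨Spread.part_one, Spread.part_two⟩
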